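/- If q^8 ≠ 1, then U_q^+(A_N) is left Noetherian and right Noetherian: every ascending chain of left ideals of U_q^+(A_N) stabilizes, and every ascending chain of right ideals of U_q^+(A_N) stabilizes. -/

import Mathlib

/-- The index set Λ_N = {(i,j) : 1 ≤ i < j ≤ N+1}. -/
def Lam (N : ℕ) : Type := {p : ℕ × ℕ // 1 ≤ p.1 ∧ p.1 < p.2 ∧ p.2 ≤ N + 1}

/-- Lexicographic linear order on Λ_N: (l,k) < (i,j) iff l < i, or l = i and k < j. -/
instance (N : ℕ) : LinearOrder (Lam N) :=
  LinearOrder.lift' (fun p => toLex p.val) (fun a b h => Subtype.ext (toLex.injective h))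

/-- The Jimbo relations defining U_q^+(A_N): here `a = (i,j)` and `b = (m,n)`. -/
inductive JimboRel (K : Type) [Field K] (q : K) (N : ℕ) :
    FreeAlgebra K (Lam N) → FreeAlgebra K (Lam N) → Prop
  /-- C1 : i = m < j < n -/
  | c1 : ∀ a b : Lam N, a.1.1 = b.1.1 → a.1.2 < b.1.2 →
      JimboRel K q N (FreeAlgebra.ι K b * FreeAlgebra.ι K a)
        ((q ^ 2)⁻¹ • (FreeAlgebra.ι K a * FreeAlgebra.ι K b))
  /-- C3 : i < m < j = n -/
  | c3 : ∀ a b : Lam N, a.1.1 < b.1.1 → a.1.2 = b.1.2 →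
      JimboRel K q N (FreeAlgebra.ι K b * FreeAlgebra.ι K a)
        ((q ^ 2)⁻¹ • (FreeAlgebra.ι K a * FreeAlgebra.ι K b))
  /-- C2 : i < m < n < j -/
  | c2 : ∀ a b : Lam N, a.1.1 < b.1.1 → b.1.2 < a.1.2 →
      JimboRel K q N (FreeAlgebra.ι K b * FreeAlgebra.ι K a)
        (FreeAlgebra.ι K a * FreeAlgebra.ι K b)
  /-- C6 : i < j < m < n -/
  | c6 : ∀ a b : Lam N, a.1.2 < b.1.1 →
      JimboRel K q N (FreeAlgebra.ι K b * FreeAlgebra.ι K a)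
        (FreeAlgebra.ι K a * FreeAlgebra.ι K b)
  /-- C4 : i < m < j < n, with c = (i,n) and d = (m,j) -/
  | c4 : ∀ a b c d : Lam N, a.1.1 < b.1.1 → b.1.1 < a.1.2 → a.1.2 < b.1.2 →
      c.1 = (a.1.1, b.1.2) → d.1 = (b.1.1, a.1.2) →
      JimboRel K q N (FreeAlgebra.ι K b * FreeAlgebra.ι K a)
        (FreeAlgebra.ι K a * FreeAlgebra.ι K b
          - (q ^ 2 - (q ^ 2)⁻¹) • (FreeAlgebra.ι K c * FreeAlgebra.ι K d))
  /-- C5 : i < j = m < n, with c = (i,n) -/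
  | c5 : ∀ a b c : Lam N, a.1.2 = b.1.1 → c.1 = (a.1.1, b.1.2) →
      JimboRel K q N (FreeAlgebra.ι K b * FreeAlgebra.ι K a)
        ((q ^ 2) • (FreeAlgebra.ι K a * FreeAlgebra.ι K b) - q • FreeAlgebra.ι K c)

/-- U_q^+(A_N): the free algebra on the X_{ij} modulo the Jimbo relations. -/
abbrev UqPlus (K : Type) [Field K] (q : K) (N : ℕ) := RingQuot (JimboRel K q N)

/-- x_{ij}: the image of the generator X_{ij} in U_q^+(A_N). -/
noncomputable def xg (K : Type) [Field K] (q : K) (N : ℕ) (p : Lam N) : UqPlus K q N :=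
  RingQuot.mkAlgHom K (JimboRel K q N) (FreeAlgebra.ι K p)

/-- The ordered monomial m_α = ∏ x_{ij}^{α(i,j)}, the product taken in <_lex-increasing order. -/
noncomputable def mon (K : Type) [Field K] (q : K) (N : ℕ) (α : Lam N →₀ ℕ) : UqPlus K q N :=
  ((α.support.sort (· ≤ ·)).map (fun p => xg K q N p ^ α p)).prod

/-- A monomial order on the finitely supported functions σ → ℕ: a well-founded strict
total order for which 0 is minimal and which is translation invariant. -/
def IsMonomialOrder (σ : Type) (r : (σ →₀ ℕ) → (σ →₀ ℕ) → Prop) : Prop :=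
  WellFounded r ∧ (∀ α, ¬ r α α) ∧ (∀ α β γ, r α β → r β γ → r α γ) ∧
  (∀ α β, α ≠ β → r α β ∨ r β α) ∧ (∀ α, α ≠ 0 → r 0 α) ∧
  (∀ α β γ, r α β → r (α + γ) (β + γ))

section OreExtension

/-! ### A Hilbert basis theorem for extensions `C = B[x]` with `xB + B = Bx + B` -/

variable {K B C : Type*} [Field K] [Ring B] [Ring C] [Algebra K B] [Algebra K C]

/-- The additive subgroup `∑_{i < n} x ^ i * φ(B)` of elements of degree less than `n`. -/
def degreeLT (φ : B →ₐ[K] C) (x : C) : ℕ → AddSubgroup C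
  | 0 => ⊥
  | n + 1 => degreeLT φ x n ⊔ (φ : B →+ C).range.map (AddMonoidHom.mulLeft (x ^ n))

variable {φ : B →ₐ[K] C} {x : C}

theorem mem_degreeLT_succ {n : ℕ} {c : C} :
    c ∈ degreeLT φ x (n + 1) ↔ ∃ b, c - x ^ n * φ b ∈ degreeLT φ x n := by
  rw [degreeLT, AddSubgroup.mem_sup]
  constructor
  · rintro ⟨y, hy, z, ⟨_, ⟨b, rfl⟩, rfl⟩, rfl⟩
    exact ⟨b, by simpa using hy⟩
  · rintro ⟨b, hb⟩
    exact ⟨_, hb, _, ⟨_, ⟨b, rfl⟩, rfl⟩, by simp⟩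

theorem degreeLT_mono : Monotone (degreeLT φ x) :=
  monotone_nat_of_le_succ fun _ => le_sup_left

theorem pow_mul_mem_degreeLT {n : ℕ} (b : B) : x ^ n * φ b ∈ degreeLT φ x (n + 1) :=
  mem_degreeLT_succ.2 ⟨b, by simp [zero_mem]⟩

theorem mul_mem_degreeLT_succ {n : ℕ} {c : C} (hc : c ∈ degreeLT φ x n) :
    x * c ∈ degreeLT φ x (n + 1) := by
  induction n generalizing c with
  | zero =>
    obtain rfl : c = 0 := hc
    simp [zero_mem]
  | succ n ih =>
    obtain ⟨b, hb⟩ := mem_degreeLT_succ.1 hc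
    refine mem_degreeLT_succ.2 ⟨b, ?_⟩
    have := ih hb
    rwa [mul_sub, ← mul_assoc, ← pow_succ'] at this

theorem mul_map_mem_degreeLT {n : ℕ} (b : B) {c : C} (hc : c ∈ degreeLT φ x n) :
    c * φ b ∈ degreeLT φ x n := by
  induction n generalizing c with
  | zero =>
    obtain rfl : c = 0 := hc
    simp [zero_mem]
  | succ n ih =>
    obtain ⟨b₁, h₁⟩ := mem_degreeLT_succ.1 hc
    refine mem_degreeLT_succ.2 ⟨b₁ * b, ?_⟩
    have := ih h₁
    rwa [sub_mul, mul_assoc, ← map_mul] at this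

theorem exists_map_mul_pow_sub_mem
    (hr : ∀ b, ∃ b' b'', φ b * x = x * φ b' + φ b'') (n : ℕ) (b : B) :
    ∃ b', φ b * x ^ n - x ^ n * φ b' ∈ degreeLT φ x n := by
  induction n generalizing b with
  | zero => exact ⟨b, by simp [zero_mem]⟩
  | succ n ih =>
    obtain ⟨b', b'', h⟩ := hr b
    obtain ⟨b₁, h₁⟩ := ih b'
    obtain ⟨b₂, h₂⟩ := ih b''
    refine ⟨b₁, ?_⟩
    have := add_mem (mul_mem_degreeLT_succ h₁) (mem_degreeLT_succ.2 ⟨b₂, h₂⟩)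
    convert this using 1
    rw [pow_succ', ← mul_assoc, h]
    noncomm_ring

theorem map_mul_mem_degreeLT
    (hr : ∀ b, ∃ b' b'', φ b * x = x * φ b' + φ b'') {n : ℕ} (b : B) {c : C}
    (hc : c ∈ degreeLT φ x n) : φ b * c ∈ degreeLT φ x n := by
  induction n generalizing c with
  | zero =>
    obtain rfl : c = 0 := hc
    simp [zero_mem]
  | succ n ih =>
    obtain ⟨b₁, h₁⟩ := mem_degreeLT_succ.1 hc
    obtain ⟨b₂, h₂⟩ := exists_map_mul_pow_sub_mem hr n b
    refine mem_degreeLT_succ.2 ⟨b₂ * b₁, ?_⟩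
    convert add_mem (ih h₁) (mul_map_mem_degreeLT b₁ h₂) using 1
    rw [map_mul]
    noncomm_ring

theorem exists_map_mul_pow_sub_pow_mul_mem
    (hl : ∀ b, ∃ b' b'', x * φ b = φ b' * x + φ b'')
    (hr : ∀ b, ∃ b' b'', φ b * x = x * φ b' + φ b'') (n : ℕ) (b : B) :
    ∃ b', φ b' * x ^ n - x ^ n * φ b ∈ degreeLT φ x n := by
  induction n generalizing b with
  | zero => exact ⟨b, by simp [zero_mem]⟩
  | succ n ih =>
    obtain ⟨b₁, h₁⟩ := ih b
    obtain ⟨b', b'', h⟩ := hl b₁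
    refine ⟨b', ?_⟩
    have h₂ : φ b'' * x ^ n ∈ degreeLT φ x (n + 1) :=
      mem_degreeLT_succ.2 (exists_map_mul_pow_sub_mem hr n b'')
    convert sub_mem (mul_mem_degreeLT_succ h₁) h₂ using 1
    rw [mul_sub, ← mul_assoc x, h, pow_succ' x n]
    noncomm_ring

theorem exists_mem_degreeLT
    (hr : ∀ b, ∃ b' b'', φ b * x = x * φ b' + φ b'')
    (hgen : Algebra.adjoin K (insert x (Set.range φ)) = ⊤) (c : C) :
    ∃ n, c ∈ degreeLT φ x n := by
  suffices h : ∀ n, ∀ d ∈ degreeLT φ x n, ∃ m, c * d ∈ degreeLT φ x m by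
    obtain ⟨m, hm⟩ := h 1 1 (by simpa using pow_mul_mem_degreeLT (φ := φ) (x := x) (n := 0) 1)
    exact ⟨m, by simpa using hm⟩
  have hc : c ∈ Algebra.adjoin K (insert x (Set.range φ)) := hgen ▸ Algebra.mem_top
  induction hc using Algebra.adjoin_induction with
  | mem y hy =>
    intro n d hd
    rcases hy with rfl | ⟨b, rfl⟩
    · exact ⟨n + 1, mul_mem_degreeLT_succ hd⟩
    · exact ⟨n, map_mul_mem_degreeLT hr b hd⟩
  | algebraMap r =>
    intro n d hd
    exact ⟨n, φ.commutes r ▸ map_mul_mem_degreeLT hr _ hd⟩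
  | add y z _ _ hy hz =>
    intro n d hd
    obtain ⟨m, hm⟩ := hy n d hd
    obtain ⟨k, hk⟩ := hz n d hd
    exact ⟨max m k, add_mul y z d ▸ add_mem (degreeLT_mono (le_max_left m k) hm)
      (degreeLT_mono (le_max_right m k) hk)⟩
  | mul y z _ _ hy hz =>
    intro n d hd
    obtain ⟨m, hm⟩ := hz n d hd
    rw [mul_assoc]
    exact hy m _ hm

/-- The left ideal of `B` of leading coefficients of the elements of `I` of degree `n`. -/
def leadingIdeal (hl : ∀ b, ∃ b' b'', x * φ b = φ b' * x + φ b'')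
    (hr : ∀ b, ∃ b' b'', φ b * x = x * φ b' + φ b'') (I : Submodule C C) (n : ℕ) :
    Submodule B B where
  carrier := {b | ∃ c ∈ I, c - x ^ n * φ b ∈ degreeLT φ x n}
  zero_mem' := ⟨0, I.zero_mem, by simp [zero_mem]⟩
  add_mem' := by
    rintro a b ⟨c, hc, h⟩ ⟨d, hd, h'⟩
    refine ⟨c + d, I.add_mem hc hd, ?_⟩
    convert add_mem h h' using 1
    rw [map_add]
    noncomm_ring
  smul_mem' := by
    rintro a b ⟨c, hc, h⟩
    obtain ⟨a', ha'⟩ := exists_map_mul_pow_sub_pow_mul_mem hl hr n a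
    refine ⟨φ a' * c, I.smul_mem _ hc, ?_⟩
    convert add_mem (map_mul_mem_degreeLT hr a' h) (mul_map_mem_degreeLT b ha') using 1
    rw [smul_eq_mul, map_mul]
    noncomm_ring

theorem leadingIdeal_mono (hl : ∀ b, ∃ b' b'', x * φ b = φ b' * x + φ b'')
    (hr : ∀ b, ∃ b' b'', φ b * x = x * φ b' + φ b'') {I J : Submodule C C} (hIJ : I ≤ J)
    {m n : ℕ} (hmn : m ≤ n) : leadingIdeal hl hr I m ≤ leadingIdeal hl hr J n := by
  have hmono : Monotone (leadingIdeal hl hr I) := by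
    refine monotone_nat_of_le_succ fun k b ⟨c, hc, h⟩ => ⟨x * c, I.smul_mem x hc, ?_⟩
    have := mul_mem_degreeLT_succ h
    rwa [mul_sub, ← mul_assoc, ← pow_succ'] at this
  exact (hmono hmn).trans fun b ⟨c, hc, h⟩ => ⟨c, hIJ hc, h⟩

theorem le_of_leadingIdeal_le (hl : ∀ b, ∃ b' b'', x * φ b = φ b' * x + φ b'')
    (hr : ∀ b, ∃ b' b'', φ b * x = x * φ b' + φ b'')
    (hgen : Algebra.adjoin K (insert x (Set.range φ)) = ⊤) {I J : Submodule C C} (hIJ : I ≤ J)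
    (h : ∀ n, leadingIdeal hl hr J n ≤ leadingIdeal hl hr I n) : J ≤ I := by
  intro c hc
  obtain ⟨n, hn⟩ := exists_mem_degreeLT hr hgen c
  induction n generalizing c with
  | zero =>
    obtain rfl : c = 0 := hn
    exact I.zero_mem
  | succ n ih =>
    obtain ⟨b, hb⟩ := mem_degreeLT_succ.1 hn
    obtain ⟨d, hd, hdb⟩ := h n ⟨c, hc, hb⟩
    have := ih (J.sub_mem hc (hIJ hd)) (by simpa using sub_mem hb hdb)
    simpa using I.add_mem this hd

/-- **Hilbert basis theorem**: if `C` is generated by the image of a left Noetherian ring `B` and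
an element `x` with `xB + B = Bx + B`, then `C` is left Noetherian. -/
theorem isNoetherianRing_of_adjoin_insert_range [IsNoetherianRing B]
    (hl : ∀ b, ∃ b' b'', x * φ b = φ b' * x + φ b'')
    (hr : ∀ b, ∃ b' b'', φ b * x = x * φ b' + φ b'')
    (hgen : Algebra.adjoin K (insert x (Set.range φ)) = ⊤) : IsNoetherianRing C := by
  refine isNoetherianRing_iff.2 (monotone_stabilizes_iff_noetherian.1 fun I => ?_)
  have hB : ∀ f : ℕ →o Submodule B B, ∃ n, ∀ m, n ≤ m → f n = f m :=
    monotone_stabilizes_iff_noetherian.2 (isNoetherianRing_iff.1 inferInstance)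
  obtain ⟨k, hk⟩ := hB ⟨fun n => leadingIdeal hl hr (I n) n,
    fun m n h => leadingIdeal_mono hl hr (I.monotone h) h⟩
  choose g hg using fun n => hB ⟨fun i => leadingIdeal hl hr (I i) n,
    fun i j h => leadingIdeal_mono hl hr (I.monotone h) le_rfl⟩
  change ∀ m, k ≤ m → leadingIdeal hl hr (I k) k = leadingIdeal hl hr (I m) m at hk
  change ∀ n m, g n ≤ m → leadingIdeal hl hr (I (g n)) n = leadingIdeal hl hr (I m) n at hg
  let M := max k ((Finset.range k).sup g)
  refine ⟨M, fun m hm => le_antisymm (I.monotone hm)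
    (le_of_leadingIdeal_le hl hr hgen (I.monotone hm) fun n => ?_)⟩
  have hkM : k ≤ M := le_max_left _ _
  rcases lt_or_ge n k with hn | hn
  · have hgM : g n ≤ M := (Finset.le_sup (Finset.mem_range.2 hn)).trans (le_max_right _ _)
    exact (hg n m (hgM.trans hm) ▸ hg n M hgM).le
  · calc leadingIdeal hl hr (I m) n
        ≤ leadingIdeal hl hr (I (max m n)) (max m n) :=
          leadingIdeal_mono hl hr (I.monotone (le_max_left _ _)) (le_max_right _ _)
      _ = leadingIdeal hl hr (I k) k := (hk _ (hn.trans (le_max_right _ _))).symm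
      _ ≤ leadingIdeal hl hr (I M) n := leadingIdeal_mono hl hr (I.monotone hkM) hn

end OreExtension

section SkewGenerators

/-! ### Algebras with generators commuting up to scalars and lower terms -/

variable {K A : Type*} [Field K] [Ring A] [Algebra K A]

theorem exists_mul_eq_of_mem_adjoin {s : Set A} {x : A}
    (h : ∀ a ∈ s, ∃ a' ∈ Algebra.adjoin K s, ∃ a'' ∈ Algebra.adjoin K s, x * a = a' * x + a'')
    {b : A} (hb : b ∈ Algebra.adjoin K s) :
    ∃ b' ∈ Algebra.adjoin K s, ∃ b'' ∈ Algebra.adjoin K s, x * b = b' * x + b'' := by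
  induction hb using Algebra.adjoin_induction with
  | mem a ha => exact h a ha
  | algebraMap r =>
    exact ⟨_, algebraMap_mem _ r, 0, zero_mem _, by rw [Algebra.commutes r x, add_zero]⟩
  | add y z _ _ hy hz =>
    obtain ⟨y', hy', y'', hy'', hxy⟩ := hy
    obtain ⟨z', hz', z'', hz'', hxz⟩ := hz
    refine ⟨_, add_mem hy' hz', _, add_mem hy'' hz'', ?_⟩
    rw [mul_add, hxy, hxz]
    noncomm_ring
  | mul y z _ hz₀ hy hz =>
    obtain ⟨y', hy', y'', hy'', hxy⟩ := hy
    obtain ⟨z', hz', z'', hz'', hxz⟩ := hz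
    refine ⟨_, mul_mem hy' hz', _, add_mem (mul_mem hy' hz'') (mul_mem hy'' hz₀), ?_⟩
    rw [← mul_assoc, hxy, add_mul, mul_assoc y', hxz]
    noncomm_ring

theorem exists_mul_eq_of_mem_adjoin_right {s : Set A} {x : A}
    (h : ∀ a ∈ s, ∃ a' ∈ Algebra.adjoin K s, ∃ a'' ∈ Algebra.adjoin K s, a * x = x * a' + a'')
    {b : A} (hb : b ∈ Algebra.adjoin K s) :
    ∃ b' ∈ Algebra.adjoin K s, ∃ b'' ∈ Algebra.adjoin K s, b * x = x * b' + b'' := by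
  induction hb using Algebra.adjoin_induction with
  | mem a ha => exact h a ha
  | algebraMap r =>
    exact ⟨_, algebraMap_mem _ r, 0, zero_mem _, by rw [Algebra.commutes r x, add_zero]⟩
  | add y z _ _ hy hz =>
    obtain ⟨y', hy', y'', hy'', hxy⟩ := hy
    obtain ⟨z', hz', z'', hz'', hxz⟩ := hz
    refine ⟨_, add_mem hy' hz', _, add_mem hy'' hz'', ?_⟩
    rw [add_mul, hxy, hxz]
    noncomm_ring
  | mul y z hy₀ _ hy hz =>
    obtain ⟨y', hy', y'', hy'', hxy⟩ := hy
    obtain ⟨z', hz', z'', hz'', hxz⟩ := hz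
    refine ⟨_, mul_mem hy' hz', _, add_mem (mul_mem hy'' hz') (mul_mem hy₀ hz''), ?_⟩
    rw [mul_assoc, hxz, mul_add, ← mul_assoc y x, hxy]
    noncomm_ring

theorem isNoetherianRing_adjoin_insert {s : Set A} [IsNoetherianRing (Algebra.adjoin K s)] {x : A}
    (h : ∀ a ∈ s, ∃ c : K, c ≠ 0 ∧ x * a - c • (a * x) ∈ Algebra.adjoin K s) :
    IsNoetherianRing (Algebra.adjoin K (insert x s)) := by
  have hs : Algebra.adjoin K s ≤ Algebra.adjoin K (insert x s) :=
    Algebra.adjoin_mono (Set.subset_insert x s)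
  refine isNoetherianRing_of_adjoin_insert_range (φ := Subalgebra.inclusion hs)
    (x := ⟨x, Algebra.subset_adjoin (Set.mem_insert x s)⟩) ?_ ?_ ?_
  · rintro ⟨b, hb⟩
    obtain ⟨b', hb', b'', hb'', e⟩ := exists_mul_eq_of_mem_adjoin (x := x) (fun a ha => by
      obtain ⟨c, -, hc⟩ := h a ha
      exact ⟨c • a, Subalgebra.smul_mem _ (Algebra.subset_adjoin ha) c, _, hc, by simp⟩) hb
    exact ⟨⟨b', hb'⟩, ⟨b'', hb''⟩, Subtype.ext e⟩
  · rintro ⟨b, hb⟩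
    obtain ⟨b', hb', b'', hb'', e⟩ := exists_mul_eq_of_mem_adjoin_right (x := x) (fun a ha => by
      obtain ⟨c, hc₀, hc⟩ := h a ha
      refine ⟨c⁻¹ • a, Subalgebra.smul_mem _ (Algebra.subset_adjoin ha) _, _,
        Subalgebra.smul_mem _ hc (-c⁻¹), ?_⟩
      rw [smul_sub, smul_smul, neg_mul, inv_mul_cancel₀ hc₀, mul_smul_comm]
      module) hb
    exact ⟨⟨b', hb'⟩, ⟨b'', hb''⟩, Subtype.ext e⟩
  · rw [eq_top_iff, ← Algebra.adjoin_adjoin_coe_preimage (R := K) (s := insert x s)]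
    refine Algebra.adjoin_mono ?_
    rintro ⟨y, hy⟩ (hyx | hys)
    · exact Or.inl (Subtype.ext hyx)
    · exact Or.inr ⟨⟨y, Algebra.subset_adjoin hys⟩, rfl⟩

theorem isNoetherianRing_adjoin_image {σ : Type*} [LinearOrder σ] (x : σ → A)
    (h : ∀ a b, a < b →
      ∃ c : K, c ≠ 0 ∧ x b * x a - c • (x a * x b) ∈ Algebra.adjoin K (x '' Set.Iio b))
    (s : Finset σ) (hs : IsLowerSet (s : Set σ)) :
    IsNoetherianRing (Algebra.adjoin K (x '' s)) := by
  induction s using Finset.induction_on_max with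
  | empty =>
    rw [Finset.coe_empty, Set.image_empty, Algebra.adjoin_empty]
    exact isNoetherianRing_of_surjective K _ (algebraMap K (⊥ : Subalgebra K A)) fun ⟨y, hy⟩ =>
      (Algebra.mem_bot.1 hy).imp fun _ => Subtype.ext
  | insert b s hb ih =>
    have hsb : (s : Set σ) = Set.Iio b := by
      ext a
      refine ⟨hb a, fun hab => ?_⟩
      have := hs (le_of_lt hab) (Finset.mem_insert_self b s)
      exact (Finset.mem_insert.1 this).resolve_left (ne_of_lt hab)
    have := ih (hsb ▸ isLowerSet_Iio b)
    rw [Finset.coe_insert, Set.image_insert_eq]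
    refine isNoetherianRing_adjoin_insert ?_
    rintro _ ⟨a, ha, rfl⟩
    rw [hsb]
    exact h a b (hb a ha)

theorem isNoetherianRing_of_skew_generators {σ : Type*} [LinearOrder σ] [Finite σ] (x : σ → A)
    (hgen : Algebra.adjoin K (Set.range x) = ⊤)
    (h : ∀ a b, a < b →
      ∃ c : K, c ≠ 0 ∧ x b * x a - c • (x a * x b) ∈ Algebra.adjoin K (x '' Set.Iio b)) :
    IsNoetherianRing A := by
  have := Fintype.ofFinite σ
  have key := isNoetherianRing_adjoin_image x h Finset.univ (by simp [isLowerSet_univ])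
  rw [Finset.coe_univ, Set.image_univ, hgen] at key
  exact isNoetherianRing_of_ringEquiv _ (Subalgebra.topEquiv (R := K) (A := A)).toRingEquiv

theorem isNoetherianRing_mulOpposite_of_skew_generators {σ : Type*} [LinearOrder σ] [Finite σ]
    (x : σ → A) (hgen : Algebra.adjoin K (Set.range x) = ⊤)
    (h : ∀ a b, a < b →
      ∃ c : K, c ≠ 0 ∧ x b * x a - c • (x a * x b) ∈ Algebra.adjoin K (x '' Set.Iio b)) :
    IsNoetherianRing Aᵐᵒᵖ := by
  have hop : ∀ t : Set A, MulOpposite.unop ⁻¹' t = MulOpposite.op '' t := fun t =>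
    (MulOpposite.opEquiv.image_eq_preimage_symm t).symm
  refine isNoetherianRing_of_skew_generators (K := K) (fun a => MulOpposite.op (x a)) ?_ ?_
  · rw [← Function.comp_def, Set.range_comp, ← hop, ← Subalgebra.op_adjoin, hgen,
      Subalgebra.op_top]
  · intro a b hab
    obtain ⟨c, hc₀, hc⟩ := h a b hab
    refine ⟨c⁻¹, inv_ne_zero hc₀, ?_⟩
    rw [← Set.image_image MulOpposite.op x, ← hop, ← Subalgebra.op_adjoin, Subalgebra.mem_op]
    convert Subalgebra.smul_mem _ hc (-c⁻¹) using 1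
    simp only [MulOpposite.unop_sub, MulOpposite.unop_smul, MulOpposite.unop_mul,
      MulOpposite.unop_op]
    rw [smul_sub, smul_smul, neg_mul, inv_mul_cancel₀ hc₀]
    module

end SkewGenerators

section UqPlus

instance (N : ℕ) : Finite (Lam N) :=
  Set.Finite.to_subtype <| ((Set.finite_Iic (N + 1)).prod (Set.finite_Iic (N + 1))).subset
    fun _ ⟨_, h₂, h₃⟩ => ⟨(h₂.trans_le h₃).le, h₃⟩

theorem Lam.lt_iff {N : ℕ} {a b : Lam N} :
    a < b ↔ a.1.1 < b.1.1 ∨ a.1.1 = b.1.1 ∧ a.1.2 < b.1.2 :=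
  Prod.Lex.toLex_lt_toLex

variable (K : Type) [Field K] (q : K) (N : ℕ)

theorem adjoin_range_xg : Algebra.adjoin K (Set.range (xg K q N)) = ⊤ := by
  have : xg K q N = RingQuot.mkAlgHom K (JimboRel K q N) ∘ FreeAlgebra.ι K := rfl
  rw [this, Set.range_comp, ← AlgHom.map_adjoin, FreeAlgebra.adjoin_range_ι, Algebra.map_top,
    AlgHom.range_eq_top]
  exact RingQuot.mkAlgHom_surjective K _

variable {K q N}

theorem xg_mul_xg_sub_mem (hq : q ≠ 0) {a b : Lam N} (hab : a < b) :
    ∃ c : K, c ≠ 0 ∧ xg K q N b * xg K q N a - c • (xg K q N a * xg K q N b) ∈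
      Algebra.adjoin K (xg K q N '' Set.Iio b) := by
  have hlow : ∀ p, p < b → xg K q N p ∈ Algebra.adjoin K (xg K q N '' Set.Iio b) :=
    fun p hp => Algebra.subset_adjoin ⟨p, hp, rfl⟩
  have hq2 : q ^ 2 ≠ 0 := pow_ne_zero 2 hq
  have ha := a.2
  have hb := b.2
  have scalar : ∀ c : K, JimboRel K q N (FreeAlgebra.ι K b * FreeAlgebra.ι K a)
      (c • (FreeAlgebra.ι K a * FreeAlgebra.ι K b)) →
      xg K q N b * xg K q N a - c • (xg K q N a * xg K q N b) ∈
        Algebra.adjoin K (xg K q N '' Set.Iio b) := by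
    intro c hc
    have := RingQuot.mkAlgHom_rel K hc
    rw [map_mul, map_smul, map_mul] at this
    rw [xg, xg, this, sub_self]
    exact zero_mem _
  rcases Lam.lt_iff.1 hab with h₁ | ⟨h₁, h₂⟩
  · rcases lt_trichotomy a.1.2 b.1.1 with h₂ | h₂ | h₂
    · exact ⟨1, one_ne_zero, scalar 1 (by simpa using JimboRel.c6 a b h₂)⟩
    · let c : Lam N := ⟨(a.1.1, b.1.2), ha.1, h₁.trans hb.2.1, hb.2.2⟩
      refine ⟨q ^ 2, hq2, ?_⟩
      have := RingQuot.mkAlgHom_rel K (JimboRel.c5 (K := K) (q := q) a b c h₂ rfl)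
      rw [map_mul, map_sub, map_smul, map_smul, map_mul] at this
      have hc := Subalgebra.smul_mem _ (hlow c (Lam.lt_iff.2 (Or.inl h₁))) (-q)
      convert hc using 1
      rw [xg, xg, xg, this]
      module
    · rcases lt_trichotomy a.1.2 b.1.2 with h₃ | h₃ | h₃
      · let c : Lam N := ⟨(a.1.1, b.1.2), ha.1, h₁.trans hb.2.1, hb.2.2⟩
        let d : Lam N := ⟨(b.1.1, a.1.2), hb.1, h₂, ha.2.2⟩
        refine ⟨1, one_ne_zero, ?_⟩
        have := RingQuot.mkAlgHom_rel K (JimboRel.c4 (K := K) (q := q) a b c d h₁ h₂ h₃ rfl rfl)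
        rw [map_mul, map_sub, map_smul, map_mul, map_mul] at this
        have hcd := Subalgebra.smul_mem _ (mul_mem (hlow c (Lam.lt_iff.2 (Or.inl h₁)))
          (hlow d (Lam.lt_iff.2 (Or.inr ⟨rfl, h₃⟩)))) (-(q ^ 2 - (q ^ 2)⁻¹))
        convert hcd using 1
        rw [xg, xg, xg, xg, this]
        module
      · exact ⟨_, inv_ne_zero hq2, scalar _ (JimboRel.c3 a b h₁ h₃)⟩
      · exact ⟨1, one_ne_zero, scalar 1 (by simpa using JimboRel.c2 a b h₁ h₃)⟩
  · exact ⟨_, inv_ne_zero hq2, scalar _ (JimboRel.c1 a b h₁ h₂)⟩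

end UqPlus

/-- A ring whose opposite is left Noetherian is Noetherian as a right module over itself. -/
theorem isNoetherian_mulOpposite_self {A : Type*} [Ring A] [IsNoetherianRing Aᵐᵒᵖ] :
    IsNoetherian Aᵐᵒᵖ A :=
  have e : Aᵐᵒᵖ ≃ₗ[Aᵐᵒᵖ] A := { MulOpposite.opAddEquiv.symm with map_smul' := fun _ _ => rfl }
  isNoetherian_of_linearEquiv e

/-- If q^8 ≠ 1 then U_q^+(A_N) is left and right Noetherian: every ascending
chain of left ideals (submodules for the left action) stabilizes, and every ascending chain
of right ideals (submodules for the right, i.e. opposite, action) stabilizes. -/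
theorem uqPlus_noetherian (K : Type) [Field K] (q : K) (hq0 : q ≠ 0)
    (hq8 : q ^ 8 ≠ 1) (N : ℕ) (hN : 1 ≤ N) :
    (∀ c : ℕ →o Submodule (UqPlus K q N) (UqPlus K q N), ∃ n, ∀ m, n ≤ m → c n = c m) ∧
    (∀ c : ℕ →o Submodule (UqPlus K q N)ᵐᵒᵖ (UqPlus K q N), ∃ n, ∀ m, n ≤ m → c n = c m) := by
  have h := fun a b : Lam N => xg_mul_xg_sub_mem (K := K) (a := a) (b := b) hq0
  have := isNoetherianRing_of_skew_generators _ (adjoin_range_xg K q N) h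
  have := isNoetherianRing_mulOpposite_of_skew_generators _ (adjoin_range_xg K q N) h
  exact ⟨monotone_stabilizes_iff_noetherian.2 (isNoetherianRing_iff.1 inferInstance),
    monotone_stabilizes_iff_noetherian.2 isNoetherian_mulOpposite_self⟩
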